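/- (Lemma 4: behaviour of the valuation under an alternating policy.) Let σ > 0, λ > 0, let 0 = θ₀ < θ₁ < ... < θ_n < θ_{n+1} = 1, and let γ : [0,1] → ℝ be continuous with γ(0) = 1 such that on each open interval (θ_j, θ_{j+1}) either γ′(t) = 0 (candid interval, π = 0) or γ′(t) = −λ·h(t)·γ(t) (sparing interval, π = 1), with the two types alternating. (i) If the first interval is candid (π = 0 near t = 0), then for every even i ≤ n: γ(θ_{i+1}) = γ(θ_i) = exp( λ·[ g(θ₁) − g(θ₂) + g(θ₃) − g(θ₄) + ... + g(θ_{i−1}) − g(θ_i) ] ) = exp( λ·Σ_{j=1}^{i} (−1)^{j+1} g(θ_j) ). (ii) If the first interval is sparing (π = 1 near t = 0), then for every odd i ≤ n: γ(θ_{i+1}) = γ(θ_i) = exp( λ·[ −g(θ₁) + g(θ₂) − g(θ₃) + ... + g(θ_{i−1}) − g(θ_i) ] ) = exp( λ·Σ_{j=1}^{i} (−1)^{j} g(θ_j) ). In both cases the sequence of values γ(θ_i) is (weakly) decreasing. -/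

import Mathlib

/-- The standard normal cumulative distribution function
`Φ(x) = (1/√(2π)) ∫_{-∞}^x e^{-u²/2} du`. -/
noncomputable def Phi (x : ℝ) : ℝ :=
  (Real.sqrt (2 * Real.pi))⁻¹ * ∫ u in Set.Iic x, Real.exp (-u ^ 2 / 2)

/-- The discount function `h(t) = 2Φ(σ(1-t)/2) - 1` for volatility `σ`. -/
noncomputable def h (σ t : ℝ) : ℝ := 2 * Phi (σ * (1 - t) / 2) - 1

/-- `g(t) = ∫₀ᵗ h(u) du`. -/
noncomputable def g (σ t : ℝ) : ℝ := ∫ u in (0:ℝ)..t, h σ u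

/-- The explicit derivative of `h`: `h′(t) = -(σ/√(2π))·exp(-σ²(1-t)²/8)`. -/
noncomputable def hDeriv (σ t : ℝ) : ℝ :=
  -(σ / Real.sqrt (2 * Real.pi)) * Real.exp (-(σ ^ 2 * (1 - t) ^ 2) / 8)

lemma gauss_int : MeasureTheory.Integrable (fun u : ℝ => Real.exp (-u ^ 2 / 2)) := by
  have := integrable_exp_neg_mul_sq (b := (1/2 : ℝ)) (by norm_num)
  refine this.congr (Filter.Eventually.of_forall fun u => ?_)
  simp only
  congr 1
  ring

lemma gauss_half : ∫ u in Set.Iic (0:ℝ), Real.exp (-u ^ 2 / 2) = Real.sqrt (2 * Real.pi) / 2 := by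
  have h1 := integral_gaussian_Ioi (1/2 : ℝ)
  have h2 := integral_comp_neg_Iic (0:ℝ) (fun u : ℝ => Real.exp (-(1/2) * u ^ 2))
  rw [neg_zero, h1] at h2
  have h3 : Real.pi / (1/2) = 2 * Real.pi := by ring
  rw [← h3, ← h2]
  congr 1
  funext u
  congr 1
  ring

lemma Phi_eq (x : ℝ) : Phi x = 1 / 2 +
    (Real.sqrt (2 * Real.pi))⁻¹ * ∫ u in (0:ℝ)..x, Real.exp (-u ^ 2 / 2) := by
  have h1 := intervalIntegral.integral_Iic_sub_Iic (a := (0:ℝ)) (b := x)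
    (gauss_int.integrableOn) (gauss_int.integrableOn)
  have hp : Real.sqrt (2 * Real.pi) ≠ 0 := by positivity
  rw [← h1, gauss_half, Phi]
  field_simp
  ring

lemma h_cont (σ : ℝ) : Continuous (h σ) := by
  have hP : Continuous Phi := by
    have : Phi = fun x => 1 / 2 +
      (Real.sqrt (2 * Real.pi))⁻¹ * ∫ u in (0:ℝ)..x, Real.exp (-u ^ 2 / 2) := funext Phi_eq
    rw [this]
    have := intervalIntegral.continuous_primitive
      (fun a b => gauss_int.intervalIntegrable (a := a) (b := b)) (0:ℝ)
    fun_prop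
  unfold h
  fun_prop

lemma h_nonneg (σ t : ℝ) (hσ : 0 < σ) (ht : t ≤ 1) : 0 ≤ h σ t := by
  unfold h
  rw [Phi_eq]
  have h0 : 0 ≤ σ * (1 - t) / 2 := by
    have : 0 ≤ 1 - t := by linarith
    positivity
  have : 0 ≤ ∫ u in (0:ℝ)..(σ * (1 - t) / 2), Real.exp (-u ^ 2 / 2) :=
    intervalIntegral.integral_nonneg h0 (fun u _ => (Real.exp_pos _).le)
  have : 0 ≤ (Real.sqrt (2 * Real.pi))⁻¹ *
      ∫ u in (0:ℝ)..(σ * (1 - t) / 2), Real.exp (-u ^ 2 / 2) := by positivity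
  linarith

lemma g_deriv (σ t : ℝ) : HasDerivAt (g σ) (h σ t) t :=
  intervalIntegral.integral_hasDerivAt_right ((h_cont σ).intervalIntegrable _ _)
    ((h_cont σ).stronglyMeasurableAtFilter _ _) (h_cont σ).continuousAt

lemma g_mono (σ a b : ℝ) (hσ : 0 < σ) (hab : a ≤ b) (hb : b ≤ 1) : g σ a ≤ g σ b := by
  have h1 : g σ b - g σ a = ∫ u in a..b, h σ u :=
    intervalIntegral.integral_interval_sub_left ((h_cont σ).intervalIntegrable _ _)
      ((h_cont σ).intervalIntegrable _ _)
  have h2 : 0 ≤ ∫ u in a..b, h σ u :=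
    intervalIntegral.integral_nonneg hab (fun u hu => h_nonneg σ u hσ (hu.2.trans hb))
  linarith

lemma const_of_deriv (f : ℝ → ℝ) (a b : ℝ) (hab : a < b) (hc : ContinuousOn f (Set.Icc a b))
    (hd : ∀ t ∈ Set.Ioo a b, HasDerivAt f 0 t) : f b = f a := by
  obtain ⟨c, _, h2⟩ := exists_hasDerivAt_eq_slope f (fun _ => 0) hab hc hd
  have : b - a ≠ 0 := by linarith
  field_simp at h2
  linarith

lemma sparing_step (σ lam : ℝ) (γ : ℝ → ℝ) (a b : ℝ) (hab : a < b)
    (hc : ContinuousOn γ (Set.Icc a b))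
    (hd : ∀ t ∈ Set.Ioo a b, HasDerivAt γ (-(lam * h σ t * γ t)) t) :
    γ b = γ a * Real.exp (-(lam * (g σ b - g σ a))) := by
  have hg : Continuous (g σ) :=
    continuous_iff_continuousAt.2 fun t => (g_deriv σ t).continuousAt
  have key := const_of_deriv (fun t => γ t * Real.exp (lam * g σ t)) a b hab
    (hc.mul (by fun_prop)) (fun t ht => by
      have := (hd t ht).mul (((g_deriv σ t).const_mul lam).exp)
      exact this.congr_deriv (by ring))
  replace key : γ b * Real.exp (lam * g σ b) = γ a * Real.exp (lam * g σ a) := key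
  have e : Real.exp (-(lam * (g σ b - g σ a))) = Real.exp (lam * g σ a) / Real.exp (lam * g σ b) := by
    rw [← Real.exp_sub]
    congr 1
    ring
  rw [e, mul_div_assoc', ← key]
  field_simp

/-- Lemma 4: behaviour of the valuation under an alternating candid/sparing policy with
switching times `0 = θ₀ < θ₁ < ... < θₙ < θ_{n+1} = 1`.  On candid intervals `γ′ = 0`, on
sparing intervals `γ′ = -λ h γ`, and the interval types alternate.
(i) If the first interval is candid then, for even `i ≤ n`,
`γ(θ_{i+1}) = γ(θ_i) = exp(λ Σ_{j=1}^{i} (-1)^{j+1} g(θ_j))`.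
(ii) If the first interval is sparing then, for odd `i ≤ n`,
`γ(θ_{i+1}) = γ(θ_i) = exp(λ Σ_{j=1}^{i} (-1)^{j} g(θ_j))`.
In both cases the sequence `γ(θ_i)` is weakly decreasing. -/
theorem stmt_19 (σ lam : ℝ) (hσ : 0 < σ) (hlam : 0 < lam)
    (n : ℕ) (θ : ℕ → ℝ) (hθ0 : θ 0 = 0) (hθlast : θ (n + 1) = 1)
    (hθmono : ∀ j ≤ n, θ j < θ (j + 1))
    (γ : ℝ → ℝ) (hγcont : ContinuousOn γ (Set.Icc 0 1)) (hγ0 : γ 0 = 1)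
    (candid : ℕ → Prop)
    (halt : ∀ j < n, (candid (j + 1) ↔ ¬ candid j))
    (hode : ∀ j ≤ n, ∀ t ∈ Set.Ioo (θ j) (θ (j + 1)),
      (candid j → HasDerivAt γ 0 t) ∧
      (¬ candid j → HasDerivAt γ (-(lam * h σ t * γ t)) t)) :
    (candid 0 → ∀ i ≤ n, Even i →
      γ (θ (i + 1)) = γ (θ i) ∧
      γ (θ i) = Real.exp (lam * ∑ j ∈ Finset.Icc 1 i, (-1 : ℝ) ^ (j + 1) * g σ (θ j))) ∧
    (¬ candid 0 → ∀ i ≤ n, Odd i →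
      γ (θ (i + 1)) = γ (θ i) ∧
      γ (θ i) = Real.exp (lam * ∑ j ∈ Finset.Icc 1 i, (-1 : ℝ) ^ j * g σ (θ j))) ∧
    (∀ i j : ℕ, i ≤ j → j ≤ n + 1 → γ (θ j) ≤ γ (θ i)) := by
  have hmon : ∀ j, ∀ i ≤ j, j ≤ n + 1 → θ i ≤ θ j := by
    intro j
    induction j with
    | zero => intro i hi _; simp [Nat.le_zero.1 hi]
    | succ j ih =>
      intro i hi hj
      rcases Nat.lt_or_ge i (j + 1) with h1 | h1
      · exact (ih i (by omega) (by omega)).trans (hθmono j (by omega)).le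
      · rw [le_antisymm hi h1]
  have hle : ∀ j ≤ n + 1, θ j ≤ 1 := fun j hj => hθlast ▸ hmon (n + 1) j hj le_rfl
  have hge : ∀ j ≤ n + 1, 0 ≤ θ j := fun j hj => hθ0 ▸ hmon j 0 (Nat.zero_le _) hj
  have hcs : ∀ j ≤ n, ContinuousOn γ (Set.Icc (θ j) (θ (j + 1))) := fun j hj =>
    hγcont.mono (Set.Icc_subset_Icc (hge j (by omega)) (hle (j + 1) (by omega)))
  have hcand : ∀ j ≤ n, candid j → γ (θ (j + 1)) = γ (θ j) := fun j hj hc =>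
    const_of_deriv γ _ _ (hθmono j hj) (hcs j hj) (fun t ht => (hode j hj t ht).1 hc)
  have hspar : ∀ j ≤ n, ¬ candid j → γ (θ (j + 1)) =
      γ (θ j) * Real.exp (-(lam * (g σ (θ (j + 1)) - g σ (θ j)))) := fun j hj hc =>
    sparing_step σ lam γ _ _ (hθmono j hj) (hcs j hj) (fun t ht => (hode j hj t ht).2 hc)
  have hg0 : g σ 0 = 0 := by simp [g]
  have hpar : ∀ j ≤ n, (candid j ↔ (candid 0 ↔ Even j)) := by
    intro j
    induction j with
    | zero => simp
    | succ j ih =>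
      intro hj
      rw [halt j (by omega), ih (by omega), Nat.even_add_one]
      tauto
  refine ⟨fun h0 => ?_, fun h0 => ?_, ?_⟩
  · have key : ∀ i ≤ n + 1, γ (θ i) = Real.exp (lam *
        (∑ j ∈ Finset.Icc 1 i, (-1 : ℝ) ^ (j + 1) * g σ (θ j) -
          if Even i then 0 else g σ (θ i))) := by
      intro i
      induction i with
      | zero => intro _; simp [hθ0, hγ0]
      | succ i ih =>
        intro hi
        have hi' : i ≤ n := by omega
        have IH := ih (by omega)
        rw [Finset.sum_Icc_succ_top (by omega)]
        by_cases he : Even i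
        · rw [hcand i hi' ((hpar i hi').2 (by tauto)), IH]
          have : ¬ Even (i + 1) := by rw [Nat.even_add_one]; tauto
          rw [if_pos he, if_neg this, (he.add (by decide : Even 2)).neg_one_pow]
          congr 1
          ring
        · rw [hspar i hi' (fun h => he (((hpar i hi').1 h).1 h0)), IH, ← Real.exp_add]
          have : Even (i + 1) := by rw [Nat.even_add_one]; exact he
          rw [if_neg he, if_pos this, (this.add_one).neg_one_pow]
          congr 1
          ring
    intro i hi he
    refine ⟨hcand i hi ((hpar i hi).2 (by tauto)), ?_⟩
    rw [key i (by omega), if_pos he, sub_zero]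
  · have key : ∀ i ≤ n + 1, γ (θ i) = Real.exp (lam *
        (∑ j ∈ Finset.Icc 1 i, (-1 : ℝ) ^ j * g σ (θ j) -
          if Even i then g σ (θ i) else 0)) := by
      intro i
      induction i with
      | zero => intro _; simp [hθ0, hγ0, hg0]
      | succ i ih =>
        intro hi
        have hi' : i ≤ n := by omega
        have IH := ih (by omega)
        rw [Finset.sum_Icc_succ_top (by omega)]
        by_cases he : Even i
        · rw [hspar i hi' (fun h => h0 (((hpar i hi').1 h).2 he)), IH, ← Real.exp_add]
          have : ¬ Even (i + 1) := by rw [Nat.even_add_one]; tauto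
          rw [if_pos he, if_neg this, (he.add_one).neg_one_pow]
          congr 1
          ring
        · rw [hcand i hi' ((hpar i hi').2 (by tauto)), IH]
          have : Even (i + 1) := by rw [Nat.even_add_one]; exact he
          rw [if_neg he, if_pos this, this.neg_one_pow]
          congr 1
          ring
    intro i hi ho
    have he : ¬ Even i := Nat.not_even_iff_odd.2 ho
    refine ⟨hcand i hi ((hpar i hi).2 (by tauto)), ?_⟩
    rw [key i (by omega), if_neg he, sub_zero]
  · have hpos : ∀ i ≤ n + 1, 0 < γ (θ i) := by
      intro i
      induction i with
      | zero => intro _; simp [hθ0, hγ0]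
      | succ i ih =>
        intro hi
        have IH := ih (by omega)
        by_cases hc : candid i
        · rw [hcand i (by omega) hc]; exact IH
        · rw [hspar i (by omega) hc]; positivity
    have hstep : ∀ i ≤ n, γ (θ (i + 1)) ≤ γ (θ i) := by
      intro i hi
      by_cases hc : candid i
      · rw [hcand i hi hc]
      · rw [hspar i hi hc]
        have h1 := g_mono σ _ _ hσ (hθmono i hi).le (hle (i + 1) (by omega))
        have h2 : 0 ≤ lam * (g σ (θ (i + 1)) - g σ (θ i)) :=
          mul_nonneg hlam.le (by linarith)
        exact mul_le_of_le_one_right (hpos i (by omega)).le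
          (Real.exp_le_one_iff.2 (by linarith))
    intro i j hij
    induction j, hij using Nat.le_induction with
    | base => intro _; exact le_rfl
    | succ j hij ih =>
      intro hj
      exact (hstep j (by omega)).trans (ih (by omega))
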